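/- arXiv:2312.16429 — 3 statements merged into one kernel-verified Lean document; each statement's English description precedes it below -/
import Mathlib

section
/- (Lemma 1: equivalence of the Wasserstein fluid and particle formulations, characteristic-curve direction.) Let Φ : ℝ × ℝⁿ → ℝ be twice continuously differentiable jointly in (t,x), let γ : ℝ → ℝ be any function, and let f : ℝ × ℝⁿ → ℝ be such that x ↦ f(t,x) is differentiable for every t. Suppose ∂ₜΦ(t,x) = −γ(t)·Φ(t,x) − (1/2)‖∇ₓΦ(t,x)‖² − f(t,x) for all (t,x). Let X : ℝ → ℝⁿ be differentiable with X′(t) = ∇ₓΦ(t, X(t)) for all t, and define V(t) := ∇ₓΦ(t, X(t)). Then V is differentiable and V′(t) = −γ(t)·V(t) − ∇ₓf(t, X(t)) for all t. -/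
open RealInnerProductSpace

/-- The linear map sending a functional on `ℝ × E` to the vector representing its space part. -/
noncomputable def spaceRep (n : ℕ) :
    ((ℝ × EuclideanSpace ℝ (Fin n)) →L[ℝ] ℝ) →ₗ[ℝ] EuclideanSpace ℝ (Fin n) where
  toFun A := (InnerProductSpace.toDual ℝ (EuclideanSpace ℝ (Fin n))).symm
    (A.comp (ContinuousLinearMap.inr ℝ ℝ (EuclideanSpace ℝ (Fin n))))
  map_add' A B := by
    rw [ContinuousLinearMap.add_comp, map_add]
  map_smul' c A := by
    rw [ContinuousLinearMap.smul_comp, map_smulₛₗ]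
    simp

theorem inner_spaceRep {n : ℕ} (A : (ℝ × EuclideanSpace ℝ (Fin n)) →L[ℝ] ℝ)
    (v : EuclideanSpace ℝ (Fin n)) : inner ℝ (spaceRep n A) v = A (0, v) := by
  simp [spaceRep]

/-- Lemma 1 (characteristic-curve direction): if `Φ : ℝ × ℝⁿ → ℝ` is C² and satisfies
the damped Hamilton–Jacobi equation `∂ₜΦ = −γ(t)Φ − (1/2)‖∇ₓΦ‖² − f` with `f(t,·)`
differentiable, and `X` solves `X′(t) = ∇ₓΦ(t, X(t))`, then `V(t) := ∇ₓΦ(t, X(t))`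
is differentiable with `V′(t) = −γ(t)V(t) − ∇ₓf(t, X(t))`. -/
theorem stmt_3 {n : ℕ} (Φ : ℝ × EuclideanSpace ℝ (Fin n) → ℝ)
    (hΦ : ContDiff ℝ 2 Φ) (γ : ℝ → ℝ)
    (f : ℝ × EuclideanSpace ℝ (Fin n) → ℝ)
    (hf : ∀ t, Differentiable ℝ (fun x => f (t, x)))
    (hHJ : ∀ t x, deriv (fun s => Φ (s, x)) t
      = -(γ t) * Φ (t, x) - (1 / 2) * ‖gradient (fun y => Φ (t, y)) x‖ ^ 2 - f (t, x))
    (X : ℝ → EuclideanSpace ℝ (Fin n))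
    (hX : ∀ t, HasDerivAt X (gradient (fun y => Φ (t, y)) (X t)) t)
    (V : ℝ → EuclideanSpace ℝ (Fin n))
    (hV : ∀ t, V t = gradient (fun y => Φ (t, y)) (X t)) :
    ∀ t, HasDerivAt V (-(γ t) • V t - gradient (fun y => f (t, y)) (X t)) t := by
  classical
  have hd : Differentiable ℝ Φ := hΦ.differentiable (by norm_num)
  have hD : Differentiable ℝ (fderiv ℝ Φ) :=
    (hΦ.fderiv_right (m := 1) (by norm_num)).differentiable (by norm_num)
  obtain ⟨L, hL⟩ : ∃ L : ((ℝ × EuclideanSpace ℝ (Fin n)) →L[ℝ] ℝ) →L[ℝ]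
      EuclideanSpace ℝ (Fin n), ∀ A v, inner ℝ (L A) v = A (0, v) :=
    ⟨LinearMap.toContinuousLinearMap (spaceRep n), fun A v => inner_spaceRep A v⟩
  have hG : ∀ t x, gradient (fun y => Φ (t, y)) x = L (fderiv ℝ Φ (t, x)) := by
    intro t x
    refine ext_inner_right ℝ fun v => ?_
    rw [hL, inner_gradient_left]
    have h := (hd (t, x)).hasFDerivAt.comp x (hasFDerivAt_prodMk_right (𝕜 := ℝ) t x)
    have h2 : fderiv ℝ (fun y => Φ (t, y)) x = _ := h.fderiv
    rw [h2]
    simp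
  have hT : ∀ t x, deriv (fun s => Φ (s, x)) t = fderiv ℝ Φ (t, x) (1, 0) := by
    intro t x
    have h := (hd (t, x)).hasFDerivAt.comp_hasDerivAt t
      ((hasDerivAt_id t).prodMk (hasDerivAt_const t x))
    exact h.deriv
  simp only [hG, hT] at hHJ hX hV
  intro t
  have hVd : HasDerivAt V (L (fderiv ℝ (fderiv ℝ Φ) (t, X t) (1, V t))) t := by
    have h1 := (hD (t, X t)).hasFDerivAt.comp_hasDerivAt t
      ((hasDerivAt_id t).prodMk (hX t))
    have h2 := L.hasFDerivAt.comp_hasDerivAt t h1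
    rw [← hV] at h2
    have h3 : V = _ := funext hV
    rw [h3]
    rw [h3] at h2
    exact h2
  convert hVd using 1
  refine ext_inner_right ℝ fun v => ?_
  rw [hL, inner_sub_left, inner_smul_left, inner_gradient_left]
  have hsymm : fderiv ℝ (fderiv ℝ Φ) (t, X t) (1, V t) (0, v)
      = fderiv ℝ (fderiv ℝ Φ) (t, X t) (0, v) (1, V t) :=
    (hΦ.contDiffAt.isSymmSndFDerivAt (by simp)).eq _ _
  have hsplit : ((1 : ℝ), V t) = (1, 0) + (0, V t) := by simp
  rw [hsymm, hsplit, map_add]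
  -- differentiate the Hamilton-Jacobi equation along a line in space
  have hi := hasFDerivAt_prodMk_right (𝕜 := ℝ) t (X t)
  have hDx := (hD (t, X t)).hasFDerivAt.comp (X t) hi
  have hl := hDx.clm_apply (hasFDerivAt_const ((1 : ℝ), (0 : EuclideanSpace ℝ (Fin n))) (X t))
  have hLD := L.hasFDerivAt.comp (X t) hDx
  have hr := ((((hd (t, X t)).hasFDerivAt.comp (X t) hi).const_mul (-(γ t))).sub
    (hLD.norm_sq.const_mul (1 / 2))).sub (hf t (X t)).hasFDerivAt
  have hl' := hl.congr_of_eventuallyEq (f₁ := fun x => -(γ t) * Φ (t, x)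
    - (1 / 2) * ‖L (fderiv ℝ Φ (t, x))‖ ^ 2 - f (t, x))
    (Filter.Eventually.of_forall fun x => (hHJ t x).symm)
  have key := congrArg (fun A => A v) (hl'.unique hr)
  have e1 := hL (fderiv ℝ (fderiv ℝ Φ) (t, X t) (0, v)) (V t)
  rw [real_inner_comm] at e1
  have e2 := hL (fderiv ℝ Φ (t, X t)) v
  rw [← hV] at e2
  simp [← hV] at key
  rw [e1, ← e2] at key
  simp
  linarith
end

section
/- (Lemma 2: equivalence of the Kalman–Wasserstein fluid and particle formulations, characteristic-curve direction.) Let Φ : ℝ × ℝⁿ → ℝ be twice continuously differentiable jointly in (t,x), γ : ℝ → ℝ any function, f : ℝ × ℝⁿ → ℝ with x ↦ f(t,x) differentiable for every t, m : ℝ → ℝⁿ any function, and for each t let C(t) and A(t) be self-adjoint continuous linear maps on ℝⁿ. Suppose ∂ₜΦ(t,x) = −γ(t)·Φ(t,x) − (1/2)(⟨x − m(t), A(t)(x − m(t))⟩ + ⟨∇ₓΦ(t,x), C(t)(∇ₓΦ(t,x))⟩) − f(t,x) for all (t,x). Let X : ℝ → ℝⁿ be differentiable with X′(t) = C(t)(∇ₓΦ(t,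 X(t))) for all t, and define V(t) := ∇ₓΦ(t, X(t)). Then V is differentiable and V′(t) = −γ(t)·V(t) − A(t)(X(t) − m(t)) − ∇ₓf(t, X(t)) for all t. -/
open RealInnerProductSpace

/-- Lemma 2 (characteristic-curve direction): if `Φ : ℝ × ℝⁿ → ℝ` is C² and satisfies
the Kalman–Wasserstein damped Hamilton–Jacobi equation
`∂ₜΦ = −γ(t)Φ − (1/2)(⟨x−m(t), A(t)(x−m(t))⟩ + ⟨∇ₓΦ, C(t)∇ₓΦ⟩) − f`, with `f(t,·)`
differentiable and `C(t)`, `A(t)` self-adjoint, and `X` solves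
`X′(t) = C(t)(∇ₓΦ(t, X(t)))`, then `V(t) := ∇ₓΦ(t, X(t))` is differentiable with
`V′(t) = −γ(t)V(t) − A(t)(X(t)−m(t)) − ∇ₓf(t, X(t))`. -/
theorem stmt_5 {n : ℕ} (Φ : ℝ × EuclideanSpace ℝ (Fin n) → ℝ)
    (hΦ : ContDiff ℝ 2 Φ) (γ : ℝ → ℝ)
    (f : ℝ × EuclideanSpace ℝ (Fin n) → ℝ)
    (hf : ∀ t, Differentiable ℝ (fun x => f (t, x)))
    (m : ℝ → EuclideanSpace ℝ (Fin n))
    (C A : ℝ → (EuclideanSpace ℝ (Fin n) →L[ℝ] EuclideanSpace ℝ (Fin n)))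
    (hC : ∀ t u v, ⟪C t u, v⟫ = ⟪u, C t v⟫)
    (hA : ∀ t u v, ⟪A t u, v⟫ = ⟪u, A t v⟫)
    (hHJ : ∀ t x, deriv (fun s => Φ (s, x)) t
      = -(γ t) * Φ (t, x)
        - (1 / 2) * (⟪x - m t, A t (x - m t)⟫
            + ⟪gradient (fun y => Φ (t, y)) x, C t (gradient (fun y => Φ (t, y)) x)⟫)
        - f (t, x))
    (X : ℝ → EuclideanSpace ℝ (Fin n))
    (hX : ∀ t, HasDerivAt X (C t (gradient (fun y => Φ (t, y)) (X t))) t)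
    (V : ℝ → EuclideanSpace ℝ (Fin n))
    (hV : ∀ t, V t = gradient (fun y => Φ (t, y)) (X t)) :
    ∀ t, HasDerivAt V
      (-(γ t) • V t - A t (X t - m t) - gradient (fun y => f (t, y)) (X t)) t := by
  intro t
  obtain ⟨L, hL⟩ : ∃ L : (EuclideanSpace ℝ (Fin n) →L[ℝ] ℝ) →L[ℝ] EuclideanSpace ℝ (Fin n),
      ∀ l, L l = (InnerProductSpace.toDual ℝ (EuclideanSpace ℝ (Fin n))).symm l :=
    ⟨LinearMap.toContinuousLinearMap
      { toFun := fun l => (InnerProductSpace.toDual ℝ (EuclideanSpace ℝ (Fin n))).symm l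
        map_add' := fun a b => by simp
        map_smul' := fun a b => by simp }, fun l => rfl⟩
  have hLi : ∀ l w, ⟪L l, w⟫ = l w := fun l w => by
    rw [hL, InnerProductSpace.toDual_symm_apply]
  have hd : Differentiable ℝ Φ := hΦ.differentiable (by norm_num)
  have hd2 : Differentiable ℝ (fderiv ℝ Φ) :=
    (hΦ.fderiv_right (m := 1) (by norm_num)).differentiable (by norm_num)
  let R := ContinuousLinearMap.inr ℝ ℝ (EuclideanSpace ℝ (Fin n))
  have hG : ∀ s x, gradient (fun y => Φ (s, y)) x = L ((fderiv ℝ Φ (s, x)).comp R) := by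
    intro s x
    have h1 : HasFDerivAt (fun y => Φ (s, y)) ((fderiv ℝ Φ (s, x)).comp R) x :=
      (hd (s, x)).hasFDerivAt.comp x (hasFDerivAt_prodMk_right s x)
    rw [gradient, h1.fderiv, hL]
  have hT : ∀ s x, deriv (fun r => Φ (r, x)) s = fderiv ℝ Φ (s, x) (1, 0) := by
    intro s x
    have h1 : HasDerivAt (fun r => (r, x)) ((1 : ℝ), (0 : EuclideanSpace ℝ (Fin n))) s :=
      (hasDerivAt_id s).prodMk (hasDerivAt_const s x)
    exact ((hd (s, x)).hasFDerivAt.comp_hasDerivAt s h1).deriv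
  set x := X t with hx
  let D := fderiv ℝ (fderiv ℝ Φ) (t, x)
  have hD : HasFDerivAt (fderiv ℝ Φ) D (t, x) := (hd2 (t, x)).hasFDerivAt
  have hsym : ∀ u v, D u v = D v u := fun u v =>
    (hΦ.contDiffAt (x := (t, x))).isSymmSndFDerivAt (by simp) u v
  let M : (ℝ × EuclideanSpace ℝ (Fin n) →L[ℝ] ℝ) →L[ℝ] EuclideanSpace ℝ (Fin n) :=
    L.comp ((ContinuousLinearMap.compL ℝ _ _ ℝ).flip R)
  have hM : ∀ l, M l = L (l.comp R) := fun l => rfl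
  have hMi : ∀ l w, ⟪M l, w⟫ = l (0, w) := fun l w => by rw [hM, hLi]; rfl
  have hVM : V = fun s => M (fderiv ℝ Φ (s, X s)) := by
    funext s; rw [hV, hG, hM]
  set Y := C t (gradient (fun y => Φ (t, y)) x) with hY
  have hXt : HasDerivAt X Y t := hX t
  have hV1 : HasDerivAt V (M (D (1, Y))) t := by
    rw [hVM]
    have h1 : HasDerivAt (fun s => (s, X s)) ((1 : ℝ), Y) t := (hasDerivAt_id t).prodMk hXt
    exact M.hasFDerivAt.comp_hasDerivAt t (HasFDerivAt.comp_hasDerivAt t hD h1)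
  convert hV1 using 1
  refine ext_inner_right ℝ fun w => ?_
  rw [hMi]
  -- differentiate along the line x + s w
  have hl : HasDerivAt (fun s : ℝ => x + s • w) w 0 := by
    simpa using ((hasDerivAt_id (0 : ℝ)).smul_const w).const_add x
  have hx0 : x + (0 : ℝ) • w = x := by simp
  have hp : HasDerivAt (fun s : ℝ => (t, x + s • w)) ((0 : ℝ), w) 0 :=
    (hasDerivAt_const _ t).prodMk hl
  have hDl : HasDerivAt (fun s : ℝ => fderiv ℝ Φ (t, x + s • w)) (D (0, w)) 0 :=
    HasFDerivAt.comp_hasDerivAt (0 : ℝ) (by rw [hx0]; exact hD) hp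
  have hleft : HasDerivAt (fun s : ℝ => fderiv ℝ Φ (t, x + s • w) (1, 0)) (D (0, w) (1, 0)) 0 := by
    simpa using hDl.clm_apply (hasDerivAt_const (0 : ℝ) ((1 : ℝ), (0 : EuclideanSpace ℝ (Fin n))))
  have hgl : HasDerivAt (fun s : ℝ => M (fderiv ℝ Φ (t, x + s • w))) (M (D (0, w))) 0 :=
    M.hasFDerivAt.comp_hasDerivAt (0 : ℝ) hDl
  have hCl := (C t).hasFDerivAt.comp_hasDerivAt (0 : ℝ) hgl
  have hml : HasDerivAt (fun s : ℝ => x + s • w - m t) w 0 := hl.sub_const _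
  have hAl := (A t).hasFDerivAt.comp_hasDerivAt (0 : ℝ) hml
  have hΦl : HasDerivAt (fun s : ℝ => Φ (t, x + s • w)) (fderiv ℝ Φ (t, x) (0, w)) 0 :=
    HasFDerivAt.comp_hasDerivAt (0 : ℝ) (by rw [hx0]; exact (hd (t, x)).hasFDerivAt) hp
  have hfl : HasDerivAt (fun s : ℝ => f (t, x + s • w))
      (fderiv ℝ (fun y => f (t, y)) x w) 0 :=
    HasFDerivAt.comp_hasDerivAt (f := fun s : ℝ => x + s • w) (l := fun y => f (t, y)) (0 : ℝ)
      (by rw [hx0]; exact (hf t x).hasFDerivAt) hl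
  have hright := ((hΦl.const_mul (-(γ t))).sub
    (((hml.inner ℝ hAl).add (hgl.inner ℝ hCl)).const_mul (1 / 2))).sub hfl
  have heq : (fun s : ℝ => fderiv ℝ Φ (t, x + s • w) (1, 0)) = fun s : ℝ =>
      -(γ t) * Φ (t, x + s • w) - (1 / 2) * (⟪x + s • w - m t, A t (x + s • w - m t)⟫
        + ⟪M (fderiv ℝ Φ (t, x + s • w)), C t (M (fderiv ℝ Φ (t, x + s • w)))⟫)
        - f (t, x + s • w) := by
    funext s
    rw [← hT, hHJ, hG, hM]
  rw [heq] at hleft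
  have key := hleft.unique hright
  have hYM : Y = C t (M (fderiv ℝ Φ (t, x))) := by rw [hY, hG, hM]
  have hVt : V t = M (fderiv ℝ Φ (t, x)) := by rw [hVM]
  have hgf : ⟪gradient (fun y => f (t, y)) x, w⟫ = fderiv ℝ (fun y => f (t, y)) x w := by
    rw [gradient, InnerProductSpace.toDual_symm_apply]
  have hsplit : D (1, Y) (0, w) = D (0, w) (1, 0) + D (0, w) (0, Y) := by
    rw [hsym, ← map_add]; simp
  simp only [Function.comp, hx0] at key
  have hYi : ⟪Y, M (D (0, w))⟫ = D (0, w) (0, Y) := by rw [real_inner_comm, hMi]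
  have hAi : ⟪w, A t (x - m t)⟫ = ⟪A t (x - m t), w⟫ := real_inner_comm _ _
  rw [← hC t (M (fderiv ℝ Φ (t, x))) (M (D (0, w))), ← hYM, hYi, hMi,
    ← hA t (x - m t) w, hAi] at key
  rw [inner_sub_left, inner_sub_left, inner_smul_left, hgf, hVt, hMi, hsplit, key]
  simp only [hMi, conj_trivial]
  ring
end

section
/- (Lemma 3: equivalence of the Stein fluid and particle formulations, characteristic-curve direction.) Let Φ : ℝ × ℝⁿ → ℝ be twice continuously differentiable jointly in (t,x), γ : ℝ → ℝ any function, f : ℝ × ℝⁿ → ℝ with x ↦ f(t,x) differentiable for every t, k : ℝⁿ × ℝⁿ → ℝ with gradient ∇ₓk in its first argument, and let (μₜ)_{t∈ℝ} be a family of finite measures on ℝⁿ. Define K(t,x) := ∫ ⟨∇ₓΦ(t,x), ∇ₓΦ(t,y)⟩·k(x,y) dμₜ(y), and suppose ∂ₜΦ(t,x) = −γ(t)·Φ(t,x) − K(t,x) − f(t,x) for all (t,x). Let X : ℝ → ℝⁿ be differentiable with X′(t) = ∫ k(X(t),y)·∇ₓΦ(t,y) dμₜ(y) (the integrand Bochner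 μₜ-integrable for every t), and set V(t) := ∇ₓΦ(t, X(t)). Assume further that for every t the map x ↦ K(t,x) is differentiable at X(t) with gradient ∇ₓK(t, X(t)) = ∇²ₓΦ(t,X(t))( ∫ k(X(t),y)·∇ₓΦ(t,y) dμₜ(y) ) + ∫ ⟨∇ₓΦ(t,X(t)), ∇ₓΦ(t,y)⟩·∇ₓk(X(t),y) dμₜ(y) (as guaranteed by differentiation under the integral sign under domination hypotheses). Then V is differentiable and V′(t) = −γ(t)·V(t) − ∫ ⟨V(t), ∇ₓΦ(t,y)⟩·∇ₓk(X(t),y) dμₜ(y) − ∇ₓf(t, X(t)) for all t. -/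
open RealInnerProductSpace MeasureTheory

/-- The spatial Riesz representative of a continuous linear form on space-time. -/
noncomputable def spaceRiesz (n : ℕ) :
    ((ℝ × EuclideanSpace ℝ (Fin n)) →L[ℝ] ℝ) →L[ℝ] EuclideanSpace ℝ (Fin n) :=
  LinearMap.toContinuousLinearMap
    { toFun := fun l => (InnerProductSpace.toDual ℝ (EuclideanSpace ℝ (Fin n))).symm
        (l.comp (ContinuousLinearMap.inr ℝ ℝ (EuclideanSpace ℝ (Fin n))))
      map_add' := fun a b => by
        rw [ContinuousLinearMap.add_comp, map_add]
      map_smul' := fun c a => by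
        rw [ContinuousLinearMap.smul_comp, map_smulₛₗ]; simp }

lemma spaceRiesz_apply {n : ℕ} (l : (ℝ × EuclideanSpace ℝ (Fin n)) →L[ℝ] ℝ) :
    spaceRiesz n l = (InnerProductSpace.toDual ℝ (EuclideanSpace ℝ (Fin n))).symm
        (l.comp (ContinuousLinearMap.inr ℝ ℝ (EuclideanSpace ℝ (Fin n)))) := rfl

/-- Lemma 3 (characteristic-curve direction, Stein metric): if `Φ : ℝ × ℝⁿ → ℝ` is C²
and satisfies `∂ₜΦ(t,x) = −γ(t)Φ(t,x) − K(t,x) − f(t,x)` where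
`K(t,x) = ∫ ⟨∇ₓΦ(t,x), ∇ₓΦ(t,y)⟩ k(x,y) dμₜ(y)`, `X` solves
`X′(t) = ∫ k(X(t),y) ∇ₓΦ(t,y) dμₜ(y)`, and the gradient of `K(t,·)` at `X(t)` is given
by differentiation under the integral sign, then `V(t) := ∇ₓΦ(t, X(t))` satisfies
`V′(t) = −γ(t)V(t) − ∫ ⟨V(t), ∇ₓΦ(t,y)⟩ ∇ₓk(X(t),y) dμₜ(y) − ∇ₓf(t, X(t))`. -/
theorem stmt_7 {n : ℕ} (Φ : ℝ × EuclideanSpace ℝ (Fin n) → ℝ)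
    (hΦ : ContDiff ℝ 2 Φ) (γ : ℝ → ℝ)
    (f : ℝ × EuclideanSpace ℝ (Fin n) → ℝ)
    (hf : ∀ t, Differentiable ℝ (fun x => f (t, x)))
    (k : EuclideanSpace ℝ (Fin n) → EuclideanSpace ℝ (Fin n) → ℝ)
    (μ : ℝ → Measure (EuclideanSpace ℝ (Fin n)))
    (hμ : ∀ t, IsFiniteMeasure (μ t))
    (K : ℝ → EuclideanSpace ℝ (Fin n) → ℝ)
    (hK : ∀ t x, K t x
      = ∫ y, ⟪gradient (fun z => Φ (t, z)) x, gradient (fun z => Φ (t, z)) y⟫ * k x y ∂(μ t))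
    (hHJ : ∀ t x, deriv (fun s => Φ (s, x)) t = -(γ t) * Φ (t, x) - K t x - f (t, x))
    (X : ℝ → EuclideanSpace ℝ (Fin n))
    (hXint : ∀ t, Integrable (fun y => k (X t) y • gradient (fun z => Φ (t, z)) y) (μ t))
    (hX : ∀ t, HasDerivAt X (∫ y, k (X t) y • gradient (fun z => Φ (t, z)) y ∂(μ t)) t)
    (V : ℝ → EuclideanSpace ℝ (Fin n))
    (hV : ∀ t, V t = gradient (fun z => Φ (t, z)) (X t))
    (hKgrad : ∀ t, HasGradientAt (fun x => K t x)
      (fderiv ℝ (gradient (fun z => Φ (t, z))) (X t)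
          (∫ y, k (X t) y • gradient (fun z => Φ (t, z)) y ∂(μ t))
        + ∫ y, ⟪gradient (fun z => Φ (t, z)) (X t), gradient (fun z => Φ (t, z)) y⟫
            • gradient (fun x' => k x' y) (X t) ∂(μ t)) (X t)) :
    ∀ t, HasDerivAt V
      (-(γ t) • V t
        - ∫ y, ⟪V t, gradient (fun z => Φ (t, z)) y⟫ • gradient (fun x' => k x' y) (X t) ∂(μ t)
        - gradient (fun y => f (t, y)) (X t)) t := by
  intro t
  have hd : Differentiable ℝ Φ := hΦ.differentiable (by norm_num)
  have hD : Differentiable ℝ (fderiv ℝ Φ) :=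
    (hΦ.fderiv_right (m := 1) (by norm_num)).differentiable (by norm_num)
  have hsl : ∀ s x, HasFDerivAt (fun z : EuclideanSpace ℝ (Fin n) => ((s, z) : ℝ × _))
      (ContinuousLinearMap.inr ℝ ℝ (EuclideanSpace ℝ (Fin n))) x := fun s x =>
    hasFDerivAt_prodMk_right s x
  have hG : ∀ s x, gradient (fun z => Φ (s, z)) x = spaceRiesz n (fderiv ℝ Φ (s, x)) := by
    intro s x
    rw [spaceRiesz_apply, gradient]
    congr 1
    exact ((hd (s, x)).hasFDerivAt.comp x (hsl s x)).fderiv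
  have hGd : ∀ s x, DifferentiableAt ℝ (fun z => Φ (s, z)) x := fun s x =>
    ((hd (s, x)).hasFDerivAt.comp x (hsl s x)).differentiableAt
  set x := X t with hx
  set w := ∫ y, k x y • gradient (fun z => Φ (t, z)) y ∂(μ t) with hw
  set D2 := fderiv ℝ (fderiv ℝ Φ) (t, x) with hD2
  have hDx : HasFDerivAt (fderiv ℝ Φ) D2 (t, x) := (hD (t, x)).hasFDerivAt
  -- derivative of `V`
  have hV' : HasDerivAt V (spaceRiesz n (D2 (1, w))) t := by
    have e : V = fun s => spaceRiesz n (fderiv ℝ Φ (s, X s)) := by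
      funext s; rw [hV, hG]
    rw [e]
    have h1 : HasDerivAt (fun s => (s, X s)) (1, w) t := (hasDerivAt_id t).prodMk (hX t)
    have h2 : HasDerivAt (fun s => fderiv ℝ Φ (s, X s)) (D2 (1, w)) t :=
      HasFDerivAt.comp_hasDerivAt t hDx h1
    exact (spaceRiesz n).hasFDerivAt.comp_hasDerivAt t h2
  have hsp : HasFDerivAt (fun z => fderiv ℝ Φ (t, z))
      (D2.comp (ContinuousLinearMap.inr ℝ ℝ (EuclideanSpace ℝ (Fin n)))) x :=
    HasFDerivAt.comp x hDx (hsl t x)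
  have hHess : fderiv ℝ (gradient (fun z => Φ (t, z))) x w = spaceRiesz n (D2 (0, w)) := by
    have e : gradient (fun z => Φ (t, z)) = fun z => spaceRiesz n (fderiv ℝ Φ (t, z)) := by
      funext z; exact hG t z
    have h3 := ((spaceRiesz n).hasFDerivAt.comp x hsp).fderiv
    rw [e]
    refine (congrArg (fun l => l w) h3).trans ?_
    simp
  -- mixed derivative
  have hsymm : ∀ a b, D2 a b = D2 b a := fun a b =>
    second_derivative_symmetric (fun y => (hd y).hasFDerivAt) hDx a b
  have hmix : HasGradientAt (fun z => fderiv ℝ Φ (t, z) (1, 0)) (spaceRiesz n (D2 (1, 0))) x := by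
    rw [hasGradientAt_iff_hasFDerivAt]
    have h := hsp.clm_apply (hasFDerivAt_const ((1 : ℝ), (0 : EuclideanSpace ℝ (Fin n))) x)
    refine h.congr_fderiv ?_
    ext v
    simp [spaceRiesz_apply, hsymm (1, 0) (0, v)]
  have hdt : ∀ z, fderiv ℝ Φ (t, z) (1, 0) = -(γ t) * Φ (t, z) - K t z - f (t, z) := by
    intro z
    rw [← hHJ t z]
    have h1 : HasDerivAt (fun s => (s, z)) ((1 : ℝ), (0 : EuclideanSpace ℝ (Fin n))) t :=
      (hasDerivAt_id t).prodMk (hasDerivAt_const t z)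
    exact (HasFDerivAt.comp_hasDerivAt t (hd (t, z)).hasFDerivAt h1).deriv.symm
  have hrhs := (((hGd t x).hasGradientAt.hasFDerivAt.const_mul (-(γ t))).sub
    (hKgrad t).hasFDerivAt).sub (hf t x).hasGradientAt.hasFDerivAt
  simp only [hdt] at hmix
  have huniq := hmix.hasFDerivAt.unique hrhs
  have key : spaceRiesz n (D2 (1, 0)) = -(γ t) • V t
      - (spaceRiesz n (D2 (0, w)) + ∫ y, ⟪V t, gradient (fun z => Φ (t, z)) y⟫
          • gradient (fun x' => k x' y) x ∂(μ t))
      - gradient (fun y => f (t, y)) x := by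
    apply (InnerProductSpace.toDual ℝ (EuclideanSpace ℝ (Fin n))).injective
    rw [huniq, hV t, ← hHess, map_sub, map_sub, map_smulₛₗ]
    rfl
  convert hV' using 1
  have : ((1 : ℝ), w) = (1, 0) + (0, w) := by simp
  rw [this, map_add, map_add, key]
  abel
end
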